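/- For any distinct even subgraphs A, B in the cycle space of a finite graph G with m vertices, there exists a path from A to B in the hypercube {0,1}^E, flipping one edge at a time, such that every intermediate edge set has at most two vertices of odd degree. -/

import Mathlib

/-- The vertices incident to an odd number of edges of `S`. -/
def oddVertices {V : Type*} [Fintype V] [DecidableEq V] (S : Finset (Sym2 V)) : Finset V :=
  Finset.univ.filter (fun v : V => ¬ Even ((S.filter (fun e => v ∈ e)).card))

theorem mem_oddVertices {V : Type*} [Fintype V] [DecidableEq V] {S : Finset (Sym2 V)} {v : V} :
    v ∈ oddVertices S ↔ ¬ Even ((S.filter (fun e => v ∈ e)).card) := by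
  simp [oddVertices]

theorem Finset.even_card_symmDiff {α : Type*} [DecidableEq α] (S T : Finset α) :
    Even (symmDiff S T).card ↔ (Even S.card ↔ Even T.card) := by
  have h : (symmDiff S T).card = (S \ T).card + (T \ S).card :=
    Finset.card_union_of_disjoint disjoint_sdiff_sdiff
  have hS := Finset.card_sdiff_add_card_inter S T
  have hT := Finset.card_sdiff_add_card_inter T S
  rw [Finset.inter_comm] at hT
  rw [h, ← hS, ← hT]
  simp only [Nat.even_add]
  tauto

theorem oddVertices_symmDiff {V : Type*} [Fintype V] [DecidableEq V] (S T : Finset (Sym2 V)) :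
    oddVertices (symmDiff S T) = symmDiff (oddVertices S) (oddVertices T) := by
  ext v
  have h : (symmDiff S T).filter (fun e => v ∈ e) =
      symmDiff (S.filter (fun e => v ∈ e)) (T.filter (fun e => v ∈ e)) := by
    ext e
    simp only [Finset.mem_filter, Finset.mem_symmDiff]
    tauto
  rw [Finset.mem_symmDiff, mem_oddVertices, mem_oddVertices, mem_oddVertices, h,
    Finset.even_card_symmDiff]
  tauto

theorem mem_oddVertices_singleton {V : Type*} [Fintype V] [DecidableEq V] {e : Sym2 V} {v : V} :
    v ∈ oddVertices {e} ↔ v ∈ e := by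
  rw [mem_oddVertices, Finset.filter_singleton]
  split_ifs with h <;> simp [h]

/-- If `D` is nonempty, one of its edges can be flipped while keeping at most two odd vertices,
starting from any edge set with the same odd vertices as `D`. -/
theorem exists_mem_card_oddVertices_symmDiff_le_two {V : Type*} [Fintype V] [DecidableEq V]
    {S D : Finset (Sym2 V)} (hD : D.Nonempty) (hodd : oddVertices D = oddVertices S)
    (hS : (oddVertices S).card ≤ 2) :
    ∃ e ∈ D, (oddVertices (symmDiff S {e})).card ≤ 2 := by
  rcases (oddVertices S).eq_empty_or_nonempty with h | ⟨u, hu⟩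
  · obtain ⟨e, he⟩ := hD
    refine ⟨e, he, ?_⟩
    induction e using Sym2.ind with
    | _ u w =>
      refine (Finset.card_le_card (t := {u, w}) fun v hv => ?_).trans Finset.card_le_two
      rw [oddVertices_symmDiff, Finset.mem_symmDiff, mem_oddVertices_singleton, h] at hv
      simpa using hv
  · have hpos : (D.filter (fun e => u ∈ e)).Nonempty := by
      rw [← hodd, mem_oddVertices] at hu
      by_contra hne
      simp [Finset.not_nonempty_iff_eq_empty.mp hne] at hu
    obtain ⟨e, he⟩ := hpos
    obtain ⟨heD, w, rfl⟩ := Finset.mem_filter.mp he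
    refine ⟨_, heD, ?_⟩
    refine (Finset.card_le_card (t := insert w ((oddVertices S).erase u)) fun v hv => ?_).trans ?_
    · rw [oddVertices_symmDiff, Finset.mem_symmDiff, mem_oddVertices_singleton, Sym2.mem_iff] at hv
      rw [Finset.mem_insert, Finset.mem_erase]
      grind
    · have := Finset.card_insert_le w ((oddVertices S).erase u)
      have := Finset.card_erase_add_one hu
      omega

/-- An edge set with at most two odd vertices is joined to any even edge set by single-edge flips
through edge sets with at most two odd vertices. -/
theorem exists_flip_path {V : Type*} [Fintype V] [DecidableEq V]
    {E B : Finset (Sym2 V)} (hB : B ⊆ E) (hBodd : oddVertices B = ∅)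
    (S : Finset (Sym2 V)) (hS : S ⊆ E) (hSodd : (oddVertices S).card ≤ 2) :
    ∃ γ : List (Finset (Sym2 V)),
      γ.head? = some S ∧ γ.getLast? = some B ∧
      γ.IsChain (fun S T => (symmDiff S T).card = 1) ∧
      ∀ T ∈ γ, T ⊆ E ∧ (oddVertices T).card ≤ 2 := by
  induction hn : (symmDiff S B).card generalizing S with
  | zero =>
    obtain rfl : S = B := symmDiff_eq_bot.mp (Finset.card_eq_zero.mp hn)
    exact ⟨[S], by simp [hS, hSodd]⟩
  | succ n ih =>
    obtain ⟨e, he, hcard⟩ := exists_mem_card_oddVertices_symmDiff_le_two (S := S)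
      (Finset.card_pos.mp (by omega : 0 < (symmDiff S B).card))
      (by rw [oddVertices_symmDiff, hBodd]; exact symmDiff_bot _) hSodd
    have hsub : symmDiff S {e} ⊆ E := by
      intro f hf
      have hfe : f ∈ S ∨ f = e := by
        rw [Finset.mem_symmDiff, Finset.mem_singleton] at hf
        tauto
      rw [Finset.mem_symmDiff] at he
      rcases hfe with h | rfl
      · exact hS h
      · exact he.elim (fun h => hS h.1) (fun h => hB h.1)
    have hn' : (symmDiff (symmDiff S {e}) B).card = n := by
      have : symmDiff (symmDiff S {e}) B = (symmDiff S B).erase e := by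
        ext f
        simp only [Finset.mem_symmDiff, Finset.mem_singleton, Finset.mem_erase] at he ⊢
        grind
      rw [this, Finset.card_erase_of_mem he, hn, Nat.add_sub_cancel]
    obtain ⟨γ, hhead, hlast, hchain, hall⟩ := ih _ hsub hcard hn'
    refine ⟨S :: γ, rfl, ?_, ?_, ?_⟩
    · rw [List.getLast?_cons, hlast, Option.getD_some]
    · refine List.isChain_cons.mpr ⟨fun T hT => ?_, hchain⟩
      obtain rfl : symmDiff S {e} = T := by simpa [hhead] using hT
      simp
    · exact List.forall_mem_cons.mpr ⟨⟨hS, hSodd⟩, hall⟩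

/-- Jerrum–Sinclair worm paths: any two distinct even subgraphs A, B of a
finite graph G are connected by a single-edge-flip path in the hypercube of
edge subsets, all of whose intermediate states have at most two odd-degree
vertices. -/
theorem stmt19 {V : Type*} [Fintype V] [DecidableEq V]
    (G : SimpleGraph V) [DecidableRel G.Adj]
    (A B : Finset (Sym2 V)) (hA : A ⊆ G.edgeFinset) (hB : B ⊆ G.edgeFinset)
    (hAeven : ∀ v : V, Even ((A.filter (fun e => v ∈ e)).card))
    (hBeven : ∀ v : V, Even ((B.filter (fun e => v ∈ e)).card))
    (hAB : A ≠ B) :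
    ∃ γ : List (Finset (Sym2 V)),
      γ.head? = some A ∧ γ.getLast? = some B ∧
      γ.Chain' (fun S T => (symmDiff S T).card = 1) ∧
      ∀ S ∈ γ, S ⊆ G.edgeFinset ∧
        (Finset.univ.filter
          (fun v : V => ¬ Even ((S.filter (fun e => v ∈ e)).card))).card ≤ 2 := by
  have odd_eq_empty {S : Finset (Sym2 V)}
      (h : ∀ v : V, Even ((S.filter (fun e => v ∈ e)).card)) : oddVertices S = ∅ :=
    Finset.filter_eq_empty_iff.mpr fun v _ => not_not.mpr (h v)
  exact exists_flip_path hB (odd_eq_empty hBeven) A hA (by simp [odd_eq_empty hAeven])
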